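/- arXiv:1606.03244 — 4 statements merged into one kernel-verified Lean document; each statement's English description precedes it below -/
import Mathlib

section
/- If an undirected graph G on n agents (n ≥ 2) has a Hamiltonian path, then for every d ≥ 1 there exists a call sequence on G of length at most 1 + (d+1)(n−2) whose final state contains every fluent of length between 2 and d+1 (so it establishes all positive epistemic goals of depth at most d). -/
/-- A fluent is a nonempty list of agents `(i_1, ..., i_r, j)` representing
`K_{i_1} ... K_{i_r} s_j`.  In the initial state a fluent is true iff `r = 0` or `i_r = j`. -/
def initState (n : ℕ) : Set (List (Fin n)) :=
  {l | (∃ j, l = [j]) ∨ ∃ p j, l = p ++ [j, j]}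

/-- A two-way call between agents `i` and `j`. -/
def callStep {n : ℕ} (i j : Fin n) (S : Set (List (Fin n))) : Set (List (Fin n)) :=
  S ∪ {l | ∃ w f : List (Fin n), l = w ++ f ∧ w ≠ [] ∧ (∀ a ∈ w, a = i ∨ a = j) ∧
        f ≠ [] ∧ (i :: f ∈ S ∨ j :: f ∈ S)}

/-- The state resulting from applying a sequence of two-way calls to the initial state. -/
def runCalls (n : ℕ) (calls : List (Fin n × Fin n)) : Set (List (Fin n)) :=
  calls.foldl (fun S c => callStep c.1 c.2 S) (initState n)

section

variable {n : ℕ}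

/-- The state obtained from `S` by a sequence of calls. -/
def runFrom (S : Set (List (Fin n))) (calls : List (Fin n × Fin n)) : Set (List (Fin n)) :=
  calls.foldl (fun S c => callStep c.1 c.2 S) S

/-- The calls along consecutive vertices of a list. -/
def pathCalls : List (Fin n) → List (Fin n × Fin n)
  | a :: b :: l => (a, b) :: pathCalls (b :: l)
  | _ => []

/-- States extending the initial one in which knowledge is factive and positively introspective. -/
structure IsEpistemic (S : Set (List (Fin n))) : Prop where
  initState_subset : initState n ⊆ S
  factive : ∀ a f, f ≠ [] → a :: f ∈ S → f ∈ S
  introspective : ∀ a f, f ≠ [] → a :: f ∈ S → a :: a :: f ∈ S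

/-- Agent `a` knows all fluents of length at most `k` in the state `S`. -/
def KnowsUpTo (S : Set (List (Fin n))) (a : Fin n) (k : ℕ) : Prop :=
  ∀ f : List (Fin n), f ≠ [] → f.length ≤ k → a :: f ∈ S

theorem subset_callStep (i j : Fin n) (S : Set (List (Fin n))) : S ⊆ callStep i j S :=
  Set.subset_union_left

theorem callStep_comm (i j : Fin n) (S : Set (List (Fin n))) :
    callStep i j S = callStep j i S := by
  simp only [callStep, or_comm]

theorem callStep_idem (i j : Fin n) (S : Set (List (Fin n))) :
    callStep i j (callStep i j S) = callStep i j S := by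
  refine Set.Subset.antisymm ?_ (subset_callStep _ _ _)
  have key : ∀ a w f, w ≠ [] → (∀ b ∈ w, b = i ∨ b = j) → f ≠ [] → (a = i ∨ a = j) →
      a :: f ∈ callStep i j S → w ++ f ∈ callStep i j S := by
    rintro a w f hw hwm hf ha (h | ⟨w', f', hl, hw', hwm', hf', h⟩)
    · exact Or.inr ⟨w, f, rfl, hw, hwm, hf, by rcases ha with rfl | rfl <;> simp [h]⟩
    · obtain ⟨c, t, rfl⟩ := List.exists_cons_of_ne_nil hw'
      simp only [List.cons_append, List.cons.injEq] at hl
      refine Or.inr ⟨w ++ t, f', by simp [hl.2], by simp [hw], ?_, hf', h⟩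
      intro b hb
      rcases List.mem_append.1 hb with hb | hb
      · exact hwm b hb
      · exact hwm' b (List.mem_cons_of_mem _ hb)
  rintro l (h | ⟨w, f, rfl, hw, hwm, hf, h | h⟩)
  · exact h
  · exact key i w f hw hwm hf (Or.inl rfl) h
  · exact key j w f hw hwm hf (Or.inr rfl) h

theorem IsEpistemic.initState : IsEpistemic (initState n) where
  initState_subset := subset_rfl
  factive := by
    rintro a f hf (⟨j, h⟩ | ⟨p, j, h⟩)
    · simp_all
    · cases p with
      | nil => exact Or.inl ⟨j, by simp_all⟩
      | cons b p => exact Or.inr ⟨p, j, by simp_all⟩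
  introspective := by
    rintro a f hf (⟨j, h⟩ | ⟨p, j, h⟩)
    · simp_all
    · exact Or.inr ⟨a :: p, j, by simp [h]⟩

theorem IsEpistemic.callStep {S : Set (List (Fin n))} (hS : IsEpistemic S) (i j : Fin n) :
    IsEpistemic (callStep i j S) where
  initState_subset := hS.initState_subset.trans (subset_callStep i j S)
  factive := by
    rintro a f hf (h | ⟨w, g, hl, hw, hwm, hg, h⟩)
    · exact Or.inl (hS.factive a f hf h)
    · obtain ⟨c, t, rfl⟩ := List.exists_cons_of_ne_nil hw
      simp only [List.cons_append, List.cons.injEq] at hl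
      obtain ⟨rfl, rfl⟩ := hl
      by_cases ht : t = []
      · subst ht
        exact Or.inl (h.elim (hS.factive _ _ hg) (hS.factive _ _ hg))
      · exact Or.inr ⟨t, g, rfl, ht, fun b hb => hwm b (List.mem_cons_of_mem _ hb), hg, h⟩
  introspective := by
    rintro a f hf (h | ⟨w, g, hl, hw, hwm, hg, h⟩)
    · exact Or.inl (hS.introspective a f hf h)
    · obtain ⟨c, t, rfl⟩ := List.exists_cons_of_ne_nil hw
      simp only [List.cons_append, List.cons.injEq] at hl
      obtain ⟨rfl, rfl⟩ := hl
      exact Or.inr ⟨a :: a :: t, g, by simp, by simp, by simpa using hwm, hg, h⟩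

theorem IsEpistemic.runFrom {S : Set (List (Fin n))} (hS : IsEpistemic S)
    (calls : List (Fin n × Fin n)) : IsEpistemic (runFrom S calls) := by
  induction calls generalizing S with
  | nil => exact hS
  | cons c cs ih => exact ih (hS.callStep c.1 c.2)

theorem runFrom_append (S : Set (List (Fin n))) (cs ds : List (Fin n × Fin n)) :
    runFrom S (cs ++ ds) = runFrom (runFrom S cs) ds :=
  List.foldl_append

theorem pathCalls_append_pair (l : List (Fin n)) (y x : Fin n) :
    pathCalls (l ++ [y, x]) = pathCalls (l ++ [y]) ++ [(y, x)] := by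
  induction l with
  | nil => rfl
  | cons a l ih => cases l <;> simp_all [pathCalls]

theorem length_pathCalls (a : Fin n) (l : List (Fin n)) :
    (pathCalls (a :: l)).length = l.length := by
  induction l generalizing a with
  | nil => rfl
  | cons b l ih => simp [pathCalls, ih]

theorem adj_of_mem_pathCalls {G : SimpleGraph (Fin n)} {l : List (Fin n)}
    (hl : l.IsChain G.Adj) : ∀ c ∈ pathCalls l, G.Adj c.1 c.2 := by
  induction l with
  | nil => simp [pathCalls]
  | cons a l ih =>
    cases l with
    | nil => simp [pathCalls]
    | cons b l =>
      rw [List.isChain_cons_cons] at hl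
      simp only [pathCalls, List.mem_cons, forall_eq_or_imp]
      exact ⟨hl.1, ih hl.2⟩

/-- Calls along a path carry the knowledge of its first agent to its last agent, who also learns
that the agents on the path have this knowledge. -/
theorem mem_runFrom_pathCalls {k : ℕ} {S : Set (List (Fin n))} (hS : IsEpistemic S)
    {p : Fin n} (hp : KnowsUpTo S p k) (A : Set (Fin n))
    (hA : ∀ a ∈ A, ∀ f : List (Fin n), f.length ≤ k → p :: a :: f ∈ S)
    (l : List (Fin n)) {z : Fin n} (hz : (p :: l).getLast? = some z) :
    ∀ a, a ∈ A ∨ a ∈ l → ∀ f : List (Fin n), f.length ≤ k →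
      z :: a :: f ∈ runFrom S (pathCalls (p :: l)) := by
  induction l generalizing S p A with
  | nil =>
    obtain rfl : p = z := by simpa using hz
    simpa [runFrom, pathCalls] using hA
  | cons q l ih =>
    have hq : KnowsUpTo (callStep p q S) q k := fun f hf hk =>
      Or.inr ⟨[q], f, rfl, by simp, by simp, hf, Or.inl (hp f hf hk)⟩
    intro a ha
    refine ih (hS.callStep p q) hq (insert q A) ?_ (by simpa using hz) a ?_
    · rintro b (rfl | hb) f hf
      · by_cases hnil : f = []
        · subst hnil
          exact subset_callStep _ _ _ (hS.initState_subset (Or.inr ⟨[], b, rfl⟩))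
        · exact Or.inr ⟨[b, b], f, rfl, by simp, by simp, hnil, Or.inl (hp f hnil hf)⟩
      · exact Or.inr ⟨[q], b :: f, rfl, by simp, by simp, by simp, Or.inl (hA b hb f hf)⟩
    · simpa [or_assoc, or_left_comm] using ha

theorem knowsUpTo_succ_of_sweep {k : ℕ} {S : Set (List (Fin n))} (hS : IsEpistemic S)
    {p : Fin n} (hp : KnowsUpTo S p k) {l : List (Fin n)} (hl : ∀ v, v ∈ p :: l)
    {z : Fin n} (hz : (p :: l).getLast? = some z) :
    KnowsUpTo (runFrom S (pathCalls (p :: l))) z (k + 1) := by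
  intro f hf hk
  obtain ⟨a, g, rfl⟩ := List.exists_cons_of_ne_nil hf
  refine mem_runFrom_pathCalls hS hp {p} ?_ l hz a (by simpa using hl a) g (by simpa using hk)
  rintro a rfl f hf
  by_cases hnil : f = []
  · subst hnil
    exact hS.initState_subset (Or.inr ⟨[], a, rfl⟩)
  · exact hS.introspective _ _ hnil (hp f hnil hf)

/-- Starting with one call, `m` alternating sweeps of a Hamiltonian path let its end agent know all
fluents of length at most `m`. Each sweep needs one call less than the path has edges, as its first
call would repeat the last one of the preceding sweep. -/
theorem exists_calls_knowsUpTo (G : SimpleGraph (Fin n)) (m : ℕ) (x y : Fin n)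
    (l : List (Fin n)) (hc : (x :: y :: l).IsChain G.Adj) (hv : ∀ v, v ∈ x :: y :: l) :
    ∃ calls : List (Fin n × Fin n), (∀ c ∈ calls, G.Adj c.1 c.2) ∧
      calls.length = 1 + m * l.length ∧ KnowsUpTo (runCalls n calls) x m ∧
      callStep x y (runCalls n calls) = runCalls n calls := by
  induction m generalizing x y l with
  | zero =>
    refine ⟨[(x, y)], ?_, by simp, ?_, callStep_idem x y _⟩
    · simpa using (List.isChain_cons_cons.1 hc).1
    · intro f hf hk
      exact absurd (List.length_eq_zero_iff.1 (Nat.le_zero.1 hk)) hf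
  | succ m ih =>
    obtain ⟨x', y', l', hrev⟩ : ∃ x' y' l', (x :: y :: l).reverse = x' :: y' :: l' := by
      rcases h : (x :: y :: l).reverse with _ | ⟨x', _ | ⟨y', l'⟩⟩
      · simpa using congrArg List.length h
      · simpa using congrArg List.length h
      · exact ⟨x', y', l', rfl⟩
    have hlen : l'.length = l.length := by simpa using (congrArg List.length hrev).symm
    have hc' : (x' :: y' :: l').IsChain G.Adj := by
      rw [← hrev, List.isChain_reverse]
      exact hc.imp fun _ _ h => h.symm
    have hv' : ∀ v, v ∈ x' :: y' :: l' := fun v => by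
      rw [← hrev, List.mem_reverse]
      exact hv v
    obtain ⟨calls, hadj, hcl, hk, hstable⟩ := ih x' y' l' hc' hv'
    have hrun : runCalls n (calls ++ pathCalls (y' :: l')) =
        runFrom (runCalls n calls) (pathCalls (x' :: y' :: l')) := by
      have h : runFrom (runCalls n calls) (pathCalls (x' :: y' :: l')) =
        runFrom (callStep x' y' (runCalls n calls)) (pathCalls (y' :: l')) := rfl
      rw [h, hstable]
      exact runFrom_append _ _ _
    refine ⟨calls ++ pathCalls (y' :: l'), ?_, ?_, ?_, ?_⟩
    · intro c hmem
      rcases List.mem_append.1 hmem with h | h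
      · exact hadj c h
      · exact adj_of_mem_pathCalls (List.isChain_cons_cons.1 hc').2 c h
    · rw [List.length_append, hcl, length_pathCalls, hlen]
      ring
    · rw [hrun]
      exact knowsUpTo_succ_of_sweep (IsEpistemic.initState.runFrom calls) hk hv'
        (by rw [← hrev]; simp)
    · have hsplit : x' :: y' :: l' = l.reverse ++ [y, x] := by rw [← hrev]; simp
      rw [hrun, hsplit, pathCalls_append_pair, runFrom_append, callStep_comm]
      exact callStep_idem y x _

end

theorem gossip_hamiltonian (n : ℕ) (hn : 2 ≤ n) (G : SimpleGraph (Fin n))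
    (hHam : ∃ vs : List (Fin n), vs.Chain' G.Adj ∧ vs.Nodup ∧ ∀ v, v ∈ vs)
    (d : ℕ) (hd : 1 ≤ d) :
    ∃ calls : List (Fin n × Fin n),
      (∀ c ∈ calls, G.Adj c.1 c.2) ∧
      calls.length ≤ 1 + (d + 1) * (n - 2) ∧
      ∀ l : List (Fin n), 2 ≤ l.length → l.length ≤ d + 1 → l ∈ runCalls n calls := by
  obtain ⟨vs, hc, hnd, hv⟩ := hHam
  have hlen : vs.length = n := by
    have huniv : vs.toFinset = Finset.univ := Finset.eq_univ_iff_forall.2 fun v => by simp [hv v]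
    rw [← List.toFinset_card_of_nodup hnd, huniv, Finset.card_univ, Fintype.card_fin]
  rcases vs with _ | ⟨x, _ | ⟨y, l⟩⟩
  · simp at hlen; omega
  · simp at hlen; omega
  · obtain ⟨calls, hadj, hcl, hk, -⟩ := exists_calls_knowsUpTo G (d + 1) x y l hc hv
    have hl : l.length = n - 2 := by simp at hlen; omega
    refine ⟨calls, hadj, (hcl.trans (by rw [hl])).le, fun f h2 hf => ?_⟩
    have hnil : f ≠ [] := by rintro rfl; simp at h2
    exact (IsEpistemic.initState.runFrom calls).factive x f hnil (hk f hnil hf)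
end

section
/- For every d ≥ 1, every undirected graph G on n agents (n ≥ 2), and every call sequence on G whose final state contains every fluent of length exactly d+1 (i.e., which establishes T_{d+1}, all positive epistemic goals of depth exactly d), the length of the call sequence is at least (d+1)(n−2). -/
section Schedules

open Finset

variable {V : Type*}

/-- The trajectory `κ` of a piece of information under the calls `c t`, `t ∈ T`: between times `u`
and `u + 1` it either stays put or crosses the call `c u`. -/
def IsWalk (T : Finset ℤ) (c : ℤ → Sym2 V) (κ : ℤ → V) : Prop :=
  ∀ u, κ (u + 1) = κ u ∨ (u ∈ T ∧ c u = s(κ u, κ (u + 1)))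

/-- Every agent's information reaches every agent. -/
def Spreads (T : Finset ℤ) (c : ℤ → Sym2 V) : Prop :=
  ∀ a b, ∃ κ, IsWalk T c κ ∧ (∃ s, ∀ u ≤ s, κ u = a) ∧ ∃ t, ∀ u ≥ t, κ u = b

/-- No information ever comes back to an agent it has left. -/
def NoReturn (T : Finset ℤ) (c : ℤ → Sym2 V) : Prop :=
  ∀ κ, IsWalk T c κ → ∀ s t u, s ≤ t → t ≤ u → κ s = κ u → κ t = κ s

/-- The call at time `t` is the first one of each of its participants. -/
def IsFirstCall (T : Finset ℤ) (c : ℤ → Sym2 V) (t : ℤ) : Prop :=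
  ∀ a ∈ c t, ∀ u ∈ T, a ∈ c u → t ≤ u

/-- The call at time `t` is the last one of each of its participants. -/
def IsLastCall (T : Finset ℤ) (c : ℤ → Sym2 V) (t : ℤ) : Prop :=
  ∀ a ∈ c t, ∀ u ∈ T, a ∈ c u → u ≤ t

/-- The set of call times of the time-reversed schedule. -/
def reverseTimes (T : Finset ℤ) : Finset ℤ := T.image fun t => -1 - t

variable {T : Finset ℤ} {c : ℤ → Sym2 V} {κ κ₁ κ₂ : ℤ → V} {x y : V} {s t : ℤ}

lemma mem_reverseTimes : t ∈ reverseTimes T ↔ -1 - t ∈ T := by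
  simp only [reverseTimes, mem_image]
  constructor
  · rintro ⟨u, hu, rfl⟩
    simpa using hu
  · exact fun h => ⟨_, h, by ring⟩

lemma reverseTimes_reverseTimes : reverseTimes (reverseTimes T) = T := by
  ext t
  simp [mem_reverseTimes]

lemma isWalk_const (x : V) : IsWalk T c fun _ => x := fun _ => Or.inl rfl

lemma IsWalk.glue (h₁ : IsWalk T c κ₁) (h₂ : IsWalk T c κ₂)
    (h : κ₂ (t + 1) = κ₁ t ∨ (t ∈ T ∧ c t = s(κ₁ t, κ₂ (t + 1)))) :
    IsWalk T c fun u => if u ≤ t then κ₁ u else κ₂ u := by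
  intro u
  rcases lt_trichotomy u t with hu | rfl | hu
  · simpa [hu.le, Int.add_one_le_iff.2 hu] using h₁ u
  · simpa using h
  · simpa [not_le.2 hu, not_le.2 (hu.trans (lt_add_one u))] using h₂ u

lemma IsWalk.reverse (h : IsWalk T c κ) :
    IsWalk (reverseTimes T) (fun t => c (-1 - t)) fun t => κ (-t) := by
  intro u
  have hu : -1 - u + 1 = -u := by ring
  have hu' : -(u + 1) = -1 - u := by ring
  rcases h (-1 - u) with h | ⟨h, h'⟩
  · left
    simp only [hu']
    rw [← h, hu]
  · right
    refine ⟨mem_reverseTimes.2 h, ?_⟩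
    simp only [hu']
    rw [h', Sym2.eq_swap, hu]

lemma Spreads.reverse (h : Spreads T c) : Spreads (reverseTimes T) fun t => c (-1 - t) := by
  intro a b
  obtain ⟨κ, hκ, ⟨s, hs⟩, t, ht⟩ := h b a
  exact ⟨_, hκ.reverse, ⟨-t, fun u hu => ht _ (by omega)⟩, -s, fun u hu => hs _ (by omega)⟩

lemma NoReturn.reverse (h : NoReturn T c) : NoReturn (reverseTimes T) fun t => c (-1 - t) := by
  intro κ hκ s t u hst htu hsu
  have hκ' := hκ.reverse
  rw [reverseTimes_reverseTimes] at hκ'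
  simp only [sub_sub_cancel] at hκ'
  have := h _ hκ' (-u) (-t) (-s) (by omega) (by omega) (by simpa using hsu.symm)
  simpa [hsu] using this

lemma isFirstCall_reverse :
    IsFirstCall (reverseTimes T) (fun t => c (-1 - t)) (-1 - t) ↔ IsLastCall T c t := by
  simp only [IsFirstCall, IsLastCall, mem_reverseTimes, sub_sub_cancel]
  refine forall₂_congr fun a _ => ⟨fun h u hu hau => ?_, fun h u hu hau => ?_⟩
  · have := h (-1 - u) (by simpa using hu) (by simpa using hau)
    omega
  · have := h _ hu hau
    omega

lemma isLastCall_reverse :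
    IsLastCall (reverseTimes T) (fun t => c (-1 - t)) (-1 - t) ↔ IsFirstCall T c t := by
  have := isFirstCall_reverse (T := reverseTimes T) (c := fun t => c (-1 - t)) (t := -1 - t)
  simpa [reverseTimes_reverseTimes] using this.symm

lemma IsWalk.eq_of_no_call (h : IsWalk T c κ) (hst : s ≤ t) (hs : κ s = x)
    (hx : ∀ u ∈ T, s ≤ u → u < t → x ∉ c u) : κ t = x := by
  induction t, hst using Int.leInduction with
  | base => exact hs
  | succ t hst ih =>
    have ih := ih fun u hu h₁ h₂ => hx u hu h₁ (by omega)
    rcases h t with h | ⟨h, h'⟩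
    · rw [h, ih]
    · exact absurd (by simp [h', ih]) (hx t h hst (by omega))

lemma IsWalk.eq_of_no_call_left (h : IsWalk T c κ) (hst : s ≤ t) (ht : κ t = x)
    (hx : ∀ u ∈ T, s ≤ u → u < t → x ∉ c u) : κ s = x := by
  induction s, hst using Int.leInductionDown with
  | base => exact ht
  | pred s hst ih =>
    have ih := ih fun u hu h₁ h₂ => hx u hu (by omega) h₂
    have hs := h (s - 1)
    rw [sub_add_cancel] at hs
    rcases hs with h | ⟨h, h'⟩
    · rw [← h, ih]
    · exact absurd (by simp [h', ih]) (hx _ h le_rfl (by omega))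

/-- If a call is the last one of one participant then it is the last one of the other. -/
lemma NoReturn.le_of_partner (hN : NoReturn T c) (hS : Spreads T c)
    (hd : ∀ t ∈ T, ¬ (c t).IsDiag) (ht : t ∈ T) (hc : c t = s(x, y))
    (hx : ∀ t' ∈ T, x ∈ c t' → t' ≤ t) : ∀ t' ∈ T, y ∈ c t' → t' ≤ t := by
  intro t' ht' hy
  by_contra! htt'
  obtain ⟨z, hz⟩ := hy
  have hyz : y ≠ z := by simpa [hz] using hd t' ht'
  obtain ⟨κ, hκ, ⟨s, hs⟩, e, he⟩ := hS z x
  have hxt : κ (t + 1) = x := hκ.eq_of_no_call_left (le_max_left (t + 1) e)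
    (he _ (le_max_right _ _)) fun u hu h₁ _ hxu => by
      have := hx u hu hxu
      omega
  have hw := (hκ.glue (κ₂ := fun _ => y) (t := t) (isWalk_const y) (by
    rcases hκ t with h | ⟨-, h⟩
    · right
      rw [← h, hxt]
      exact ⟨ht, hc⟩
    · left
      rw [hxt, hc, Sym2.eq_swap, Sym2.congr_left] at h
      exact h)).glue (κ₂ := fun _ => z) (t := t') (isWalk_const z) (by
        right
        simp [not_le.2 htt', ht', hz])
  have := hN _ hw (min s t) t' (t' + 1) (by omega) (by omega)
    (by simpa [(min_le_right s t).trans htt'.le] using hs _ (min_le_left s t))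
  have h2 : min s t ≤ t' := by omega
  simp only [le_refl, if_true, not_le.2 htt', if_false, h2, min_le_right,
    hs _ (min_le_left s t)] at this
  exact hyz this

lemma Spreads.exists_call [Nontrivial V] (hS : Spreads T c) (x : V) : ∃ t ∈ T, x ∈ c t := by
  by_contra! h
  obtain ⟨y, hy⟩ := exists_ne x
  obtain ⟨κ, hκ, ⟨s, hs⟩, t, ht⟩ := hS x y
  have := hκ.eq_of_no_call (le_max_left s t) (hs s le_rfl) fun u hu _ _ => h u hu
  exact hy (by rw [← this, ht _ (le_max_right _ _)])

lemma NoReturn.exists_isLastCall [Nontrivial V] (hN : NoReturn T c) (hS : Spreads T c)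
    (hd : ∀ t ∈ T, ¬ (c t).IsDiag) (x : V) : ∃ t ∈ T, x ∈ c t ∧ IsLastCall T c t := by
  classical
  obtain ⟨t₀, ht₀, hx₀⟩ := hS.exists_call x
  obtain ⟨t, ht, hmax⟩ := exists_max_image (T.filter fun t => x ∈ c t) id
    ⟨t₀, mem_filter.2 ⟨ht₀, hx₀⟩⟩
  rw [mem_filter] at ht
  have hx : ∀ t' ∈ T, x ∈ c t' → t' ≤ t := fun t' h h' => hmax t' (mem_filter.2 ⟨h, h'⟩)
  refine ⟨t, ht.1, ht.2, ?_⟩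
  obtain ⟨y, hy⟩ := ht.2
  intro a ha
  rw [hy, Sym2.mem_iff] at ha
  rcases ha with rfl | rfl
  · exact hx
  · exact hN.le_of_partner hS hd ht.1 hy hx

lemma NoReturn.exists_isFirstCall [Nontrivial V] (hN : NoReturn T c) (hS : Spreads T c)
    (hd : ∀ t ∈ T, ¬ (c t).IsDiag) (x : V) : ∃ t ∈ T, x ∈ c t ∧ IsFirstCall T c t := by
  obtain ⟨t, ht, hx, hl⟩ := hN.reverse.exists_isLastCall hS.reverse
    (fun t ht => hd _ (mem_reverseTimes.1 ht)) x
  exact ⟨-1 - t, mem_reverseTimes.1 ht, hx, isLastCall_reverse.1 (by simpa using hl)⟩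

lemma not_isFirstCall_of_isLastCall [Fintype V] (hV : 2 < Fintype.card V) (hS : Spreads T c)
    (ht : t ∈ T) (hl : IsLastCall T c t) : ¬ IsFirstCall T c t := by
  classical
  intro hf
  obtain ⟨a, b, hab⟩ : ∃ a b, c t = s(a, b) := ⟨_, _, (Quot.out_eq (c t)).symm⟩
  obtain ⟨z, hz⟩ : ∃ z, z ∉ c t := by
    by_contra! h
    have : (univ : Finset V) ⊆ {a, b} := fun z _ => by simpa [hab] using h z
    have := (card_le_card this).trans card_le_two
    rw [card_univ] at this
    omega
  obtain ⟨κ, hκ, ⟨s, hs⟩, e, he⟩ := hS z a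
  have key : ∀ u, s ≤ u → κ u ∉ c t := by
    intro u hu
    induction u, hu using Int.leInduction with
    | base => rwa [hs s le_rfl]
    | succ u hu ih =>
      rcases hκ u with h | ⟨h, h'⟩
      · rwa [h]
      · intro hmem
        have hu₁ : κ (u + 1) ∈ c u := by simp [h']
        have hut : u = t := le_antisymm (hl _ hmem u h hu₁) (hf _ hmem u h hu₁)
        subst hut
        exact ih (by simp [h'])
  exact key (max s e) (le_max_left _ _) (by simp [he _ (le_max_right s e), hab])

/-- If some information returns to the agent `p`, then `p` can be removed at the cost of two
calls: an agent carrying that information while it is away from `p` takes over the role of `p`. -/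
lemma Spreads.exists_remove (hS : Spreads T c) (hN : ¬ NoReturn T c) :
    ∃ (p : V) (T' : Finset ℤ) (c' : ℤ → Sym2 {a // a ≠ p}), Spreads T' c' ∧
      (∀ t ∈ T', ¬ (c' t).IsDiag) ∧ T'.card + 2 ≤ T.card := by
  classical
  simp only [NoReturn, not_forall] at hN
  obtain ⟨κ, hκ, s, t, e, hst, hte, hse, hts⟩ := hN
  obtain ⟨p, hp⟩ : ∃ p, κ s = p := ⟨_, rfl⟩
  rw [hp] at hse hts
  obtain ⟨t₀, ⟨ht₀t, ht₀⟩, hmax⟩ := Int.exists_greatest_of_bdd (P := fun u => u ≤ t ∧ κ u = p)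
    ⟨t, fun u hu => hu.1⟩ ⟨s, hst, hp⟩
  obtain ⟨t₁, ⟨ht₁t, ht₁⟩, hmin⟩ := Int.exists_least_of_bdd (P := fun u => t ≤ u ∧ κ u = p)
    ⟨t, fun u hu => hu.1⟩ ⟨e, hte, hse.symm⟩
  have h₀ : t₀ < t := lt_of_le_of_ne ht₀t (by rintro rfl; exact hts ht₀)
  have h₁ : t < t₁ := lt_of_le_of_ne ht₁t (by rintro rfl; exact hts ht₁)
  have hout : ∀ u, t₀ < u → u < t₁ → κ u ≠ p := by
    intro u hu₀ hu₁ hu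
    rcases le_total u t with h | h
    · exact absurd (hmax u ⟨h, hu⟩) (by omega)
    · exact absurd (hmin u ⟨h, hu⟩) (by omega)
  obtain ⟨k, hk⟩ : ∃ k : ℤ → V, ∀ u, k u = κ (max (t₀ + 1) (min u (t₁ - 1))) := ⟨_, fun _ => rfl⟩
  have hkp : ∀ u, k u ≠ p := fun u => by
    rw [hk]
    exact hout _ (by omega) (by omega)
  have hkw : IsWalk T c k := by
    intro u
    by_cases hu : t₀ + 1 ≤ u ∧ u + 1 ≤ t₁ - 1
    · have e₁ : max (t₀ + 1) (min u (t₁ - 1)) = u := by omega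
      have e₂ : max (t₀ + 1) (min (u + 1) (t₁ - 1)) = u + 1 := by omega
      simpa only [hk, e₁, e₂] using hκ u
    · left
      rw [hk, hk]
      congr 1
      omega
  have hc₀ : t₀ ∈ T ∧ c t₀ = s(p, k t₀) := by
    have e₁ : max (t₀ + 1) (min t₀ (t₁ - 1)) = t₀ + 1 := by omega
    rw [hk, e₁]
    rcases hκ t₀ with h | h
    · exact absurd (h.trans ht₀) (hout _ (by omega) (by omega))
    · rwa [ht₀] at h
  have hc₁ : t₁ - 1 ∈ T ∧ c (t₁ - 1) = s(p, k (t₁ - 1)) := by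
    have e₁ : max (t₀ + 1) (min (t₁ - 1) (t₁ - 1)) = t₁ - 1 := by omega
    rw [hk, e₁]
    have h := hκ (t₁ - 1)
    rw [sub_add_cancel, ht₁] at h
    rcases h with h | h
    · exact absurd h.symm (hout _ (by omega) (by omega))
    · rwa [Sym2.eq_swap] at h
  have hkc : ∀ u, p ∈ c u → k (u + 1) = k u := by
    intro u hu
    rcases hkw u with h | ⟨-, h⟩
    · exact h
    · rw [h, Sym2.mem_iff] at hu
      rcases hu with hu | hu
      · exact absurd hu.symm (hkp u)
      · exact absurd hu.symm (hkp (u + 1))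
  let π : ℤ → V → {a // a ≠ p} := fun u a => if h : a = p then ⟨k u, hkp u⟩ else ⟨a, h⟩
  have hπp : ∀ u, π u p = ⟨k u, hkp u⟩ := fun u => by simp [π]
  have hπ : ∀ u a (h : a ≠ p), π u a = ⟨a, h⟩ := fun u a h => by simp [π, h]
  have hπc : ∀ u, p ∈ c u → π (u + 1) = π u := fun u hu => by
    funext a
    simp only [π, hkc u hu]
  refine ⟨p, ((T.erase t₀).erase (t₁ - 1)).filter fun u => ¬ ((c u).map (π u)).IsDiag,
    fun u => (c u).map (π u), ?_, fun u hu => (mem_filter.1 hu).2, ?_⟩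
  · intro a b
    obtain ⟨ω, hω, ⟨s, hs⟩, e, he⟩ := hS a b
    refine ⟨fun u => π u (ω u), fun u => ?_, ⟨s, fun u hu => ?_⟩, e, fun u hu => ?_⟩
    · rw [or_iff_not_imp_left]
      intro (hne : π (u + 1) (ω (u + 1)) ≠ π u (ω u))
      suffices h : u ∈ T ∧ u ≠ t₀ ∧ u ≠ t₁ - 1 ∧
          (c u).map (π u) = s(π u (ω u), π (u + 1) (ω (u + 1))) by
        obtain ⟨hT, hu₀, hu₁, hcu⟩ := h
        refine ⟨mem_filter.2 ⟨mem_erase.2 ⟨hu₁, mem_erase.2 ⟨hu₀, hT⟩⟩, ?_⟩, hcu⟩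
        rw [hcu, Sym2.mk_isDiag_iff]
        exact fun h => hne h.symm
      have hsep : p ∉ c u → u ≠ t₀ ∧ u ≠ t₁ - 1 := by
        intro h
        constructor
        · rintro rfl
          exact h (by simp [hc₀.2])
        · rintro rfl
          exact h (by simp [hc₁.2])
      rcases hω u with h | ⟨hT, hcu⟩
      · rw [h] at hne ⊢
        by_cases hp' : ω u = p
        · rw [hp', hπp, hπp] at hne ⊢
          rcases hkw u with h' | ⟨hT, hcu⟩
          · exact absurd (Subtype.ext h') hne
          · have hpc : p ∉ c u := by
              rw [hcu, Sym2.mem_iff]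
              exact fun h => h.elim (fun h => hkp _ h.symm) fun h => hkp _ h.symm
            refine ⟨hT, (hsep hpc).1, (hsep hpc).2, ?_⟩
            rw [hcu, Sym2.map_mk, hπ _ _ (hkp _), hπ _ _ (hkp _)]
        · exact absurd (by rw [hπ _ _ hp', hπ _ _ hp']) hne
      · by_cases hpc : p ∈ c u
        · have hmerge : c u ≠ s(p, k u) := by
            intro h
            apply hne
            rw [hπc u hpc]
            have hpk : π u p = π u (k u) := by rw [hπp, hπ _ _ (hkp u)]
            rw [hcu, Sym2.eq_iff] at h
            rcases h with ⟨h, h'⟩ | ⟨h, h'⟩ <;> rw [h, h', hpk]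
          refine ⟨hT, ?_, ?_, ?_⟩
          · rintro rfl
            exact hmerge hc₀.2
          · rintro rfl
            exact hmerge hc₁.2
          · rw [hπc u hpc, hcu, Sym2.map_mk]
        · refine ⟨hT, (hsep hpc).1, (hsep hpc).2, ?_⟩
          rw [hcu, Sym2.mem_iff, not_or] at hpc
          rw [hcu, Sym2.map_mk, hπ u _ (Ne.symm hpc.2), hπ (u + 1) _ (Ne.symm hpc.2)]
    · simp only [hs u hu, hπ u a a.2]
    · simp only [he u hu, hπ u b b.2]
  · have h₂ : t₁ - 1 ∈ T.erase t₀ := by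
      refine mem_erase.2 ⟨fun h => ?_, hc₁.1⟩
      exact hout t h₀ h₁ (by rw [show t = t₀ by omega, ht₀])
    have := card_filter_le ((T.erase t₀).erase (t₁ - 1)) fun u => ¬ ((c u).map (π u)).IsDiag
    have := card_erase_add_one h₂
    have := card_erase_add_one hc₀.1
    omega

lemma card_le_card_add_one_of_reachable [Fintype V] (E : Finset (Sym2 V)) (x : V)
    (h : ∀ y, (SimpleGraph.fromEdgeSet (E : Set (Sym2 V))).Reachable x y) :
    Fintype.card V ≤ E.card + 1 := by
  have hconn : (SimpleGraph.fromEdgeSet (E : Set (Sym2 V))).Connected :=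
    SimpleGraph.connected_iff_exists_forall_reachable _ |>.2 ⟨x, h⟩
  have h₁ := hconn.card_vert_le_card_edgeSet_add_one
  have h₂ : Nat.card (SimpleGraph.fromEdgeSet (E : Set (Sym2 V))).edgeSet ≤ E.card := by
    rw [SimpleGraph.edgeSet_fromEdgeSet, Nat.card_coe_set_eq]
    exact (Set.ncard_le_ncard Set.sdiff_subset E.finite_toSet).trans
      (Set.ncard_coe_finset E).le
  rw [Nat.card_eq_fintype_card] at h₁
  omega

open Classical in
/-- The calls that can carry information from `x` onwards. -/
noncomputable def outgoingCalls (T : Finset ℤ) (c : ℤ → Sym2 V) (x : V) : Finset ℤ :=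
  T.filter fun t => ∃ κ, IsWalk T c κ ∧ (∃ s ≤ t, κ s = x) ∧ κ (t + 1) ≠ κ t

open Classical in
/-- The calls that can carry information which later reaches `x`. -/
noncomputable def incomingCalls (T : Finset ℤ) (c : ℤ → Sym2 V) (x : V) : Finset ℤ :=
  T.filter fun t => ∃ κ, IsWalk T c κ ∧ (∃ s > t, κ s = x) ∧ κ (t + 1) ≠ κ t

lemma mem_outgoingCalls_reverse (ht : t ∈ incomingCalls T c x) :
    -1 - t ∈ outgoingCalls (reverseTimes T) (fun t => c (-1 - t)) x := by
  classical
  obtain ⟨hT, κ, hκ, ⟨s, hs, hx⟩, hne⟩ := mem_filter.1 ht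
  refine mem_filter.2 ⟨mem_reverseTimes.2 (by simpa using hT), _, hκ.reverse,
    ⟨-s, by omega, by simpa using hx⟩, ?_⟩
  have e₁ : -(-1 - t + 1) = t := by ring
  have e₂ : -(-1 - t) = t + 1 := by ring
  simpa only [e₁, e₂] using hne.symm

lemma mem_incomingCalls_reverse (ht : t ∈ outgoingCalls T c x) :
    -1 - t ∈ incomingCalls (reverseTimes T) (fun t => c (-1 - t)) x := by
  classical
  obtain ⟨hT, κ, hκ, ⟨s, hs, hx⟩, hne⟩ := mem_filter.1 ht
  refine mem_filter.2 ⟨mem_reverseTimes.2 (by simpa using hT), _, hκ.reverse,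
    ⟨-s, by omega, by simpa using hx⟩, ?_⟩
  have e₁ : -(-1 - t + 1) = t := by ring
  have e₂ : -(-1 - t) = t + 1 := by ring
  simpa only [e₁, e₂] using hne.symm

lemma Spreads.card_le_outgoingCalls [Fintype V] (hS : Spreads T c) (x : V) :
    Fintype.card V ≤ (outgoingCalls T c x).card + 1 := by
  classical
  refine (card_le_card_add_one_of_reachable ((outgoingCalls T c x).image c) x fun y => ?_).trans
    (Nat.add_le_add_right card_image_le 1)
  obtain ⟨κ, hκ, ⟨s, hs⟩, t, ht⟩ := hS x y
  rw [← ht (max s t) (le_max_right _ _)]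
  have hst := le_max_left s t
  generalize max s t = u at hst
  induction u, hst using Int.leInduction with
  | base => rw [hs s le_rfl]
  | succ u hu ih =>
    by_cases hne : κ (u + 1) = κ u
    · rwa [hne]
    · obtain ⟨hT, hcu⟩ := (hκ u).resolve_left hne
      refine ih.trans (SimpleGraph.Adj.reachable ?_)
      rw [SimpleGraph.fromEdgeSet_adj, ← hcu]
      refine ⟨mem_coe.2 (mem_image_of_mem c (mem_filter.2 ⟨hT, κ, hκ, ⟨s, hu, hs s le_rfl⟩, hne⟩)),
        fun h => hne h.symm⟩

lemma Spreads.card_le_incomingCalls [Fintype V] (hS : Spreads T c) (x : V) :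
    Fintype.card V ≤ (incomingCalls T c x).card + 1 := by
  refine (hS.reverse.card_le_outgoingCalls x).trans (Nat.add_le_add_right ?_ 1)
  refine card_le_card_of_injOn (fun t => -1 - t) (fun t ht => ?_) fun a _ b _ h => by
    simpa using h
  have := mem_incomingCalls_reverse ht
  simpa [reverseTimes_reverseTimes] using this

lemma NoReturn.mem_call (hN : NoReturn T c) (ho : t ∈ outgoingCalls T c x)
    (hi : t ∈ incomingCalls T c x) : x ∈ c t := by
  classical
  obtain ⟨hT, κ₁, h₁, ⟨s₁, hs₁, hx₁⟩, hne₁⟩ := mem_filter.1 ho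
  obtain ⟨-, κ₂, h₂, ⟨s₂, hs₂, hx₂⟩, hne₂⟩ := mem_filter.1 hi
  have hc₁ := ((h₁ t).resolve_left hne₁).2
  have hc₂ := ((h₂ t).resolve_left hne₂).2
  have hw := h₁.glue (t := t) h₂ (by
    have h := hc₁
    rw [hc₂, Sym2.eq_iff] at h
    rcases h with ⟨h, -⟩ | ⟨-, h⟩
    · right
      exact ⟨hT, by rw [hc₂, h]⟩
    · exact Or.inl h)
  have := hN _ hw s₁ t s₂ hs₁ hs₂.le (by simp [hs₁, not_le.2 hs₂, hx₁, hx₂])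
  simp only [le_refl, if_true, hs₁, hx₁] at this
  rw [hc₁, this]
  exact Sym2.mem_mk_left _ _

/-- Before being passed on in a last call, information from `x` only crosses calls that are neither
first nor last, and the first call of `x`. -/
lemma reachable_of_mem_outgoingCalls (H : SimpleGraph V)
    (hmid : ∀ u ∈ T, ¬ IsFirstCall T c u → ¬ IsLastCall T c u → ∀ a b, c u = s(a, b) →
      H.Reachable a b)
    (hfirst : ∀ u ∈ T, IsFirstCall T c u → ∀ b, c u = s(x, b) → H.Reachable x b)
    (ht : t ∈ outgoingCalls T c x) (hl : ¬ IsLastCall T c t) :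
    ∀ a ∈ c t, H.Reachable x a := by
  classical
  obtain ⟨hT, κ, hκ, ⟨s, hs, hx⟩, hne⟩ := mem_filter.1 ht
  have hct := ((hκ t).resolve_left hne).2
  have key : ∀ u, s ≤ u → u ≤ t + 1 → H.Reachable x (κ u) := by
    intro u hu
    induction u, hu using Int.leInduction with
    | base => exact fun _ => hx ▸ SimpleGraph.Reachable.refl _
    | succ u hu ih =>
      intro hut
      have ih := ih (by omega)
      rcases hκ u with h | ⟨h, hcu⟩
      · rwa [h]
      · have hlu : ¬ IsLastCall T c u := by
          intro hlu
          rcases (show u ≤ t by omega).eq_or_lt with rfl | hlt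
          · exact hl hlu
          · have hlast := hlu (κ (u + 1)) (by simp [hcu])
            have : κ t = κ (u + 1) := hκ.eq_of_no_call (by omega : u + 1 ≤ t) rfl
              fun v hv h₁ _ hmem => by
                have := hlast v hv hmem
                omega
            have := hlast t hT (by simp [hct, this])
            omega
        by_cases hfu : IsFirstCall T c u
        · have hux : κ u = x := by
            rw [← hx]
            refine (hκ.eq_of_no_call_left hu rfl fun v hv _ h₂ hmem => ?_).symm
            have := hfu (κ u) (by simp [hcu]) v hv hmem
            omega
          exact hfirst u h hfu _ (by rw [hcu, hux])
        · exact ih.trans (hmid u h hfu hlu _ _ hcu)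
  intro a ha
  rw [hct, Sym2.mem_iff] at ha
  rcases ha with rfl | rfl
  · exact key t hs (by omega)
  · exact key (t + 1) (by omega) le_rfl

lemma reachable_of_mem_incomingCalls (H : SimpleGraph V)
    (hmid : ∀ u ∈ T, ¬ IsFirstCall T c u → ¬ IsLastCall T c u → ∀ a b, c u = s(a, b) →
      H.Reachable a b)
    (hlast : ∀ u ∈ T, IsLastCall T c u → ∀ b, c u = s(x, b) → H.Reachable x b)
    (ht : t ∈ incomingCalls T c x) (hf : ¬ IsFirstCall T c t) :
    ∀ a ∈ c t, H.Reachable x a := by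
  have := reachable_of_mem_outgoingCalls (T := reverseTimes T) (c := fun t => c (-1 - t))
    (x := x) (t := -1 - t) H
    (fun u hu h₁ h₂ => hmid (-1 - u) (mem_reverseTimes.1 hu)
      (fun h => h₂ (by simpa using isLastCall_reverse.2 h))
      fun h => h₁ (by simpa using isFirstCall_reverse.2 h))
    (fun u hu h => hlast (-1 - u) (mem_reverseTimes.1 hu)
      (isFirstCall_reverse.1 (by simpa using h)))
    (mem_outgoingCalls_reverse ht) (fun h => hf (isLastCall_reverse.1 h))
  simpa using this

open Classical in
lemma sum_card_filter_mem_call [Fintype V] (hd : ∀ t ∈ T, ¬ (c t).IsDiag) :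
    ∑ x, (T.filter fun t => x ∈ c t).card = 2 * T.card := by
  have h := sum_card_bipartiteAbove_eq_sum_card_bipartiteBelow (s := (univ : Finset V)) (t := T)
    fun x t => x ∈ c t
  simp only [bipartiteAbove, bipartiteBelow] at h
  rw [h, sum_const_nat (m := 2), mul_comm]
  intro t ht
  obtain ⟨a, b, hab⟩ : ∃ a b, c t = s(a, b) := ⟨_, _, (Quot.out_eq (c t)).symm⟩
  have hne : a ≠ b := by simpa [hab] using hd t ht
  rw [← card_pair hne]
  congr 1
  ext z
  simp [hab]

open Classical in
/-- Without returning information there are at least `2 * card V - 4` calls. -/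
lemma NoReturn.two_mul_card_le [Fintype V] (hN : NoReturn T c) (hS : Spreads T c)
    (hd : ∀ t ∈ T, ¬ (c t).IsDiag) : 2 * Fintype.card V ≤ T.card + 4 := by
  by_contra! hlt
  have hV : 2 < Fintype.card V := by omega
  have : Nontrivial V := Fintype.one_lt_card_iff_nontrivial.1 (by omega)
  have hfirst := hN.exists_isFirstCall hS hd
  have hlast := hN.exists_isLastCall hS hd
  set F := T.filter (IsFirstCall T c) with hF
  set L := T.filter (IsLastCall T c) with hL
  have hF1 : ∀ x, (F.filter fun t => x ∈ c t).card = 1 := by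
    intro x
    obtain ⟨t, ht, hx, hft⟩ := hfirst x
    refine card_eq_one.2 ⟨t, eq_singleton_iff_unique_mem.2 ⟨by simp [hF, ht, hx, hft], ?_⟩⟩
    intro u hu
    simp only [hF, mem_filter] at hu
    exact le_antisymm (hu.1.2 x hu.2 t ht hx) (hft x hx u hu.1.1 hu.2)
  have hL1 : ∀ x, (L.filter fun t => x ∈ c t).card = 1 := by
    intro x
    obtain ⟨t, ht, hx, hft⟩ := hlast x
    refine card_eq_one.2 ⟨t, eq_singleton_iff_unique_mem.2 ⟨by simp [hL, ht, hx, hft], ?_⟩⟩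
    intro u hu
    simp only [hL, mem_filter] at hu
    exact le_antisymm (hft x hx u hu.1.1 hu.2) (hu.1.2 x hu.2 t ht hx)
  have hFcard : 2 * F.card = Fintype.card V := by
    rw [← sum_card_filter_mem_call (T := F) (c := c) fun t ht => hd t (mem_filter.1 ht).1,
      sum_congr rfl fun x _ => hF1 x]
    simp
  have hLcard : 2 * L.card = Fintype.card V := by
    rw [← sum_card_filter_mem_call (T := L) (c := c) fun t ht => hd t (mem_filter.1 ht).1,
      sum_congr rfl fun x _ => hL1 x]
    simp
  have hdisj : Disjoint F L := by
    rw [disjoint_left]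
    intro t htF htL
    exact not_isFirstCall_of_isLastCall hV hS (mem_filter.1 htL).1 (mem_filter.1 htL).2
      (mem_filter.1 htF).2
  have hFL : (F ∪ L).card = Fintype.card V := by
    rw [card_union_of_disjoint hdisj]
    omega
  have hFLT : F ∪ L ⊆ T := union_subset (filter_subset _ _) (filter_subset _ _)
  set M := T \ (F ∪ L) with hM
  have hMcard : M.card + Fintype.card V = T.card := by
    rw [← hFL, hM, card_sdiff_add_card_eq_card hFLT]
  have hOI : ∀ x, 2 * Fintype.card V ≤ (outgoingCalls T c x ∪ incomingCalls T c x).card +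
      (T.filter fun t => x ∈ c t).card + 2 := by
    intro x
    have h₁ := hS.card_le_outgoingCalls x
    have h₂ := hS.card_le_incomingCalls x
    have h₃ := card_union_add_card_inter (outgoingCalls T c x) (incomingCalls T c x)
    have h₄ : outgoingCalls T c x ∩ incomingCalls T c x ⊆ T.filter fun t => x ∈ c t := by
      intro t ht
      rw [mem_inter] at ht
      exact mem_filter.2 ⟨(mem_filter.1 ht.1).1, hN.mem_call ht.1 ht.2⟩
    have h₅ := card_le_card h₄
    omega
  have hOIT : ∀ x, outgoingCalls T c x ∪ incomingCalls T c x ⊆ T := fun x =>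
    union_subset (filter_subset _ _) (filter_subset _ _)
  have hmiddle : ∀ x, ∃ t ∈ M, x ∈ c t := by
    intro x
    by_contra! h
    have h₁ : T.filter (fun t => x ∈ c t) ⊆
        (F.filter fun t => x ∈ c t) ∪ (L.filter fun t => x ∈ c t) := by
      intro t ht
      rw [mem_filter] at ht
      by_contra hFt
      refine h t (mem_sdiff.2 ⟨ht.1, fun h' => hFt ?_⟩) ht.2
      rw [← filter_union]
      exact mem_filter.2 ⟨h', ht.2⟩
    have h₂ := (card_le_card h₁).trans (card_union_le _ _)
    rw [hF1, hL1] at h₂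
    have h₃ := hOI x
    have h₄ := card_le_card (hOIT x)
    omega
  have hproper : ∀ x, outgoingCalls T c x ∪ incomingCalls T c x ≠ T := by
    intro x hx
    obtain ⟨f, hfT, ⟨y, hy⟩, hff⟩ := hfirst x
    obtain ⟨l, hlT, ⟨z, hz⟩, hll⟩ := hlast x
    set E : Finset (Sym2 V) := insert s(x, y) (insert s(x, z) (M.image c)) with hE
    have hE' : ∀ a b, s(a, b) ∈ E →
        (SimpleGraph.fromEdgeSet (E : Set (Sym2 V))).Reachable a b := by
      intro a b hab
      by_cases h : a = b
      · rw [h]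
      · exact SimpleGraph.Adj.reachable ((SimpleGraph.fromEdgeSet_adj _).2 ⟨hab, h⟩)
    have hmid : ∀ u ∈ T, ¬ IsFirstCall T c u → ¬ IsLastCall T c u → ∀ a b, c u = s(a, b) →
        (SimpleGraph.fromEdgeSet (E : Set (Sym2 V))).Reachable a b := by
      intro u hu h₁ h₂ a b hab
      refine hE' a b (mem_insert_of_mem (mem_insert_of_mem ?_))
      rw [← hab]
      exact mem_image_of_mem c (by simp [hM, hF, hL, hu, h₁, h₂])
    have hEcard : E.card ≤ M.card + 2 := by
      rw [hE]
      exact (card_insert_le _ _).trans (Nat.add_le_add_right ((card_insert_le _ _).trans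
        (Nat.add_le_add_right card_image_le 1)) 1)
    have := card_le_card_add_one_of_reachable E x fun a => by
      obtain ⟨t, htM, hat⟩ := hmiddle a
      have htT : t ∈ T := (mem_sdiff.1 htM).1
      have htF : ¬ IsFirstCall T c t := fun h =>
        (mem_sdiff.1 htM).2 (mem_union_left _ (mem_filter.2 ⟨htT, h⟩))
      have htL : ¬ IsLastCall T c t := fun h =>
        (mem_sdiff.1 htM).2 (mem_union_right _ (mem_filter.2 ⟨htT, h⟩))
      rw [← hx, mem_union] at htT
      rcases htT with ht | ht
      · refine reachable_of_mem_outgoingCalls _ hmid (fun u hu hfu b hb => hE' x b ?_) ht htL a hat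
        have huf : u = f := le_antisymm (hfu x (by simp [hb]) f hfT (by simp [hy]))
          (hff x (by simp [hy]) u hu (by simp [hb]))
        rw [← hb, huf, hy]
        exact mem_insert_self _ _
      · refine reachable_of_mem_incomingCalls _ hmid (fun u hu hlu b hb => hE' x b ?_) ht htF a hat
        have hul : u = l := le_antisymm (hll x (by simp [hz]) u hu (by simp [hb]))
          (hlu x (by simp [hb]) l hlT (by simp [hz]))
        rw [← hb, hul, hz]
        exact mem_insert_of_mem (mem_insert_self _ _)
    omega
  have hdeg : ∀ x ∈ (univ : Finset V), 4 ≤ (T.filter fun t => x ∈ c t).card := by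
    intro x _
    have h₁ := card_lt_card ((hOIT x).ssubset_of_ne (hproper x))
    have h₂ := hOI x
    omega
  have := card_nsmul_le_sum _ _ _ hdeg
  rw [sum_card_filter_mem_call hd, card_univ, smul_eq_mul] at this
  omega

/-- A schedule spreading all information among `card V` agents has at least `2 * card V - 4`
calls. -/
theorem Spreads.two_mul_card_le {V : Type*} [Fintype V] {T : Finset ℤ} {c : ℤ → Sym2 V}
    (hS : Spreads T c) (hd : ∀ t ∈ T, ¬ (c t).IsDiag) : 2 * Fintype.card V ≤ T.card + 4 := by
  classical
  obtain ⟨m, hm⟩ : ∃ m, Fintype.card V = m := ⟨_, rfl⟩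
  induction m generalizing V T with
  | zero => omega
  | succ m ih =>
    by_cases hN : NoReturn T c
    · exact hN.two_mul_card_le hS hd
    · obtain ⟨p, T', c', hS', hd', hcard⟩ := hS.exists_remove hN
      have hp : Fintype.card {a // a ≠ p} + 1 = Fintype.card V := by
        have : Fintype.card {a // a ≠ p} = Fintype.card V - 1 := by
          simp [Fintype.card_subtype_compl]
        omega
      have := ih hS' hd' (by omega)
      omega

end Schedules

section Fluents

variable {n : ℕ}

lemma runCalls_append (l₁ l₂ : List (Fin n × Fin n)) :
    runCalls n (l₁ ++ l₂) = l₂.foldl (fun S c => callStep c.1 c.2 S) (runCalls n l₁) :=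
  List.foldl_append

lemma runCalls_concat (l : List (Fin n × Fin n)) (c : Fin n × Fin n) :
    runCalls n (l ++ [c]) = callStep c.1 c.2 (runCalls n l) := by
  rw [runCalls_append]
  rfl

lemma cons_mem_callStep {i j a : Fin n} {f : List (Fin n)} {S : Set (List (Fin n))} (hf : f ≠ [])
    (hS : ∀ a f, f ≠ [] → a :: f ∈ S → f ∈ S) (h : a :: f ∈ callStep i j S) :
    a :: f ∈ S ∨ ((a = i ∨ a = j) ∧ f ∈ callStep i j S) := by
  rcases h with h | ⟨w, g, hl, hw, hmem, hg, hknow⟩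
  · exact Or.inl h
  · right
    match w, hw with
    | b :: w, _ =>
      rw [List.cons_append, List.cons.injEq] at hl
      obtain ⟨rfl, rfl⟩ := hl
      refine ⟨hmem a (by simp), ?_⟩
      by_cases hw' : w = []
      · subst hw'
        exact Or.inl (hknow.elim (hS _ _ hg) (hS _ _ hg))
      · exact Or.inr ⟨w, g, rfl, hw', fun b hb => hmem b (by simp [hb]), hg, hknow⟩

/-- Known fluents are true. -/
lemma mem_runCalls_of_cons_mem (calls : List (Fin n × Fin n)) :
    ∀ (a : Fin n) (f : List (Fin n)), f ≠ [] → a :: f ∈ runCalls n calls →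
      f ∈ runCalls n calls := by
  induction calls using List.reverseRecOn with
  | nil =>
    rintro a f hf (⟨j, hj⟩ | ⟨p, j, hp⟩)
    · simp_all
    · match p with
      | [] =>
        rw [List.nil_append, List.cons.injEq] at hp
        exact Or.inl ⟨j, hp.2⟩
      | b :: p =>
        rw [List.cons_append, List.cons.injEq] at hp
        exact Or.inr ⟨p, j, hp.2⟩
  | append_singleton l c ih =>
    intro a f hf h
    rw [runCalls_concat] at h ⊢
    exact (cons_mem_callStep hf ih h).elim (fun h => Or.inl (ih a f hf h)) fun h => h.2

open Classical in
/-- The agents knowing the fluent `f` in the state `S`. -/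
noncomputable def knowers (f : List (Fin n)) (S : Set (List (Fin n))) : Finset (Fin n) :=
  Finset.univ.filter fun a => a :: f ∈ S

lemma runCalls_subset_concat (l : List (Fin n × Fin n)) (c : Fin n × Fin n) :
    runCalls n l ⊆ runCalls n (l ++ [c]) := by
  rw [runCalls_concat]
  exact Set.subset_union_left

lemma runCalls_subset_append (l₁ l₂ : List (Fin n × Fin n)) :
    runCalls n l₁ ⊆ runCalls n (l₁ ++ l₂) := by
  induction l₂ using List.reverseRecOn with
  | nil => simp
  | append_singleton l c ih =>
    rw [← List.append_assoc]
    exact ih.trans (runCalls_subset_concat _ _)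

/-- Positive introspection. -/
lemma cons_cons_mem_runCalls (calls : List (Fin n × Fin n)) (a : Fin n) (f : List (Fin n))
    (hf : f ≠ []) (h : a :: f ∈ runCalls n calls) : a :: a :: f ∈ runCalls n calls := by
  induction calls using List.reverseRecOn with
  | nil =>
    rcases h with ⟨j, hj⟩ | ⟨p, j, hp⟩
    · simp_all
    · exact Or.inr ⟨a :: p, j, by rw [hp, List.cons_append]⟩
  | append_singleton l c ih =>
    rw [runCalls_concat] at h ⊢
    rcases h with h | ⟨w, g, hl, hw, hmem, hg, hS⟩
    · exact Or.inl (ih h)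
    · refine Or.inr ⟨a :: w, g, by rw [hl, List.cons_append], by simp, ?_, hg, hS⟩
      match w, hw with
      | b :: w, _ =>
        rw [List.cons_append, List.cons.injEq] at hl
        obtain ⟨rfl, -⟩ := hl
        simpa using hmem

/-- A call makes a false fluent known to at most the two callers. -/
lemma card_knowers_concat_le_two (l : List (Fin n × Fin n)) (c : Fin n × Fin n)
    {f : List (Fin n)} (hf : f ≠ []) (hfl : f ∉ runCalls n l) :
    (knowers f (runCalls n (l ++ [c]))).card ≤ 2 := by
  classical
  refine (Finset.card_le_card (t := {c.1, c.2}) fun a ha => ?_).trans Finset.card_le_two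
  have ha := (Finset.mem_filter.1 ha).2
  rw [runCalls_concat] at ha
  rcases cons_mem_callStep hf (mem_runCalls_of_cons_mem l) ha with h | h
  · exact absurd (mem_runCalls_of_cons_mem l a f hf h) hfl
  · simpa using h.1

/-- A call makes a true fluent known to at most one more agent. -/
lemma card_knowers_concat_le (l : List (Fin n × Fin n)) (c : Fin n × Fin n)
    {f : List (Fin n)} (hf : f ≠ []) (hfl : f ∈ runCalls n l) :
    (knowers f (runCalls n (l ++ [c]))).card ≤ (knowers f (runCalls n l)).card + 1 := by
  classical
  suffices h : ∃ b, knowers f (runCalls n (l ++ [c])) ⊆ insert b (knowers f (runCalls n l)) by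
    obtain ⟨b, hb⟩ := h
    exact (Finset.card_le_card hb).trans (Finset.card_insert_le _ _)
  have hsub : ∀ a ∈ knowers f (runCalls n (l ++ [c])), a ∈ knowers f (runCalls n l) ∨
      ((a = c.1 ∨ a = c.2) ∧ (c.1 ∈ knowers f (runCalls n l) ∨
        c.2 ∈ knowers f (runCalls n l))) := by
    intro a ha
    simp only [knowers, Finset.mem_filter, Finset.mem_univ, true_and] at ha ⊢
    rw [runCalls_concat] at ha
    rcases ha with ha | ⟨w, g, hl, hw, hmem, hg, hS⟩
    · exact Or.inl ha
    · right
      match w, hw with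
      | [b], _ =>
        rw [List.cons_append, List.nil_append, List.cons.injEq] at hl
        obtain ⟨rfl, rfl⟩ := hl
        exact ⟨hmem a (by simp), hS⟩
      | b :: b' :: w, _ =>
        rw [List.cons_append, List.cons.injEq] at hl
        obtain ⟨rfl, rfl⟩ := hl
        refine ⟨hmem a (by simp), ?_⟩
        have h := cons_cons_mem_runCalls l b' (w ++ g) (by simp [hg]) hfl
        rcases hmem b' (by simp) with rfl | rfl
        · exact Or.inl h
        · exact Or.inr h
  by_cases h₁ : c.1 ∈ knowers f (runCalls n l)
  · refine ⟨c.2, fun a ha => Finset.mem_insert.2 ?_⟩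
    rcases hsub a ha with h | ⟨rfl | rfl, -⟩
    · exact Or.inr h
    · exact Or.inr h₁
    · exact Or.inl rfl
  · refine ⟨c.1, fun a ha => Finset.mem_insert.2 ?_⟩
    rcases hsub a ha with h | ⟨rfl | rfl, h⟩
    · exact Or.inr h
    · exact Or.inl rfl
    · exact Or.inr (h.resolve_left h₁)

lemma card_knowers_append_le (l₁ l₂ : List (Fin n × Fin n)) {f : List (Fin n)} (hf : f ≠ [])
    (hfl : f ∈ runCalls n l₁) :
    (knowers f (runCalls n (l₁ ++ l₂))).card ≤ (knowers f (runCalls n l₁)).card + l₂.length := by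
  induction l₂ using List.reverseRecOn with
  | nil => simp
  | append_singleton l c ih =>
    have := card_knowers_concat_le (l₁ ++ l) c hf (runCalls_subset_append l₁ l hfl)
    rw [List.append_assoc] at this
    rw [List.length_append, List.length_singleton]
    omega

/-- Information about a secret travels along walks. -/
lemma exists_isWalk_of_mem_runCalls (calls : List (Fin n × Fin n)) (c : ℤ → Sym2 (Fin n))
    (hc : ∀ (k : ℕ) (hk : k < calls.length), c k = s(calls[k].1, calls[k].2)) (a b : Fin n)
    (k : ℕ) (hk : k ≤ calls.length) (h : [a, b] ∈ runCalls n (calls.take k)) :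
    ∃ κ, IsWalk (Finset.Ico 0 (calls.length : ℤ)) c κ ∧ (∀ u ≤ 0, κ u = b) ∧
      ∀ u ≥ (k : ℤ), κ u = a := by
  induction k generalizing a with
  | zero =>
    have hab : a = b := by
      rw [List.take_zero] at h
      rcases h with ⟨j, hj⟩ | ⟨p, j, hp⟩
      · simp at hj
      · match p with
        | [] => simp_all
        | e :: p => simpa using congrArg List.length hp
    subst hab
    exact ⟨_, isWalk_const a, fun _ _ => rfl, fun _ _ => rfl⟩
  | succ k ih =>
    rw [← List.take_concat_get' _ _ hk, runCalls_concat] at h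
    have hck := hc k hk
    have extend : ∀ a', [a', b] ∈ runCalls n (calls.take k) → (a' = a ∨ c k = s(a', a)) →
        ∃ κ, IsWalk (Finset.Ico 0 (calls.length : ℤ)) c κ ∧ (∀ u ≤ 0, κ u = b) ∧
          ∀ u ≥ ((k + 1 : ℕ) : ℤ), κ u = a := by
      intro a' h' hmove
      obtain ⟨κ, hκ, hs, he⟩ := ih a' (by omega) h'
      refine ⟨_, hκ.glue (t := k) (isWalk_const a) ?_, fun u hu => ?_, fun u hu => ?_⟩
      · rw [he k le_rfl]
        exact hmove.imp Eq.symm fun h => ⟨by simp; omega, h⟩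
      · simp [hs u hu, show u ≤ (k : ℤ) by omega]
      · simp [show ¬ u ≤ (k : ℤ) by omega]
    rcases h with h | ⟨w, f, hl, hw, hmem, hf, hS⟩
    · exact extend a h (Or.inl rfl)
    · match w, f, hw, hf with
      | [e], [e'], _, _ =>
        simp only [List.cons_append, List.nil_append, List.cons.injEq, and_true] at hl
        obtain ⟨rfl, rfl⟩ := hl
        rcases hmem a (by simp) with ha | ha <;> rcases hS with h | h
        · exact extend _ h (Or.inl ha.symm)
        · exact extend _ h (Or.inr (by rw [hck, ha, Sym2.eq_swap]))
        · exact extend _ h (Or.inr (by rw [hck, ha]))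
        · exact extend _ h (Or.inl ha.symm)
      | _ :: _ :: _, _ :: _, _, _ =>
        have := congrArg List.length hl
        simp at this
      | [_], _ :: _ :: _, _, _ =>
        have := congrArg List.length hl
        simp at this

lemma two_mul_sub_two_le_length (hn : 2 ≤ n) (calls : List (Fin n × Fin n))
    (hvalid : ∀ c ∈ calls, c.1 ≠ c.2)
    (hgoal : ∀ l : List (Fin n), l.length = 2 → l ∈ runCalls n calls) :
    2 * (n - 2) ≤ calls.length := by
  let x₀ : Fin n := ⟨0, by omega⟩
  let c : ℤ → Sym2 (Fin n) := fun u =>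
    if h : u.toNat < calls.length then s(calls[u.toNat].1, calls[u.toNat].2) else s(x₀, x₀)
  have hc : ∀ (k : ℕ) (hk : k < calls.length), c k = s(calls[k].1, calls[k].2) := by
    intro k hk
    simp [c, hk]
  have hS : Spreads (Finset.Ico 0 (calls.length : ℤ)) c := by
    intro b a
    obtain ⟨κ, hκ, hs, he⟩ := exists_isWalk_of_mem_runCalls calls c hc a b calls.length le_rfl
      (by simpa using hgoal [a, b] rfl)
    exact ⟨κ, hκ, ⟨_, hs⟩, _, he⟩
  have := hS.two_mul_card_le fun t ht => by
    rw [Finset.mem_Ico] at ht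
    obtain ⟨k, rfl⟩ := Int.eq_ofNat_of_zero_le ht.1
    rw [hc k (by omega), Sym2.mk_isDiag_iff]
    exact hvalid _ (List.getElem_mem _)
  rw [Fintype.card_fin, Int.card_Ico] at this
  omega

lemma mul_sub_two_le_length (hn : 2 ≤ n) (d : ℕ) (hd : 1 ≤ d) (calls : List (Fin n × Fin n))
    (hvalid : ∀ c ∈ calls, c.1 ≠ c.2)
    (hgoal : ∀ l : List (Fin n), l.length = d + 1 → l ∈ runCalls n calls) :
    (d + 1) * (n - 2) ≤ calls.length := by
  classical
  induction d, hd using Nat.le_induction generalizing calls with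
  | base => exact two_mul_sub_two_le_length hn calls hvalid hgoal
  | succ d hd ih =>
    let x₀ : Fin n := ⟨0, by omega⟩
    let x₁ : Fin n := ⟨1, by omega⟩
    have hex : ∃ k, ∀ l : List (Fin n), l.length = d + 1 → l ∈ runCalls n (calls.take k) := by
      refine ⟨calls.length, fun l hl => ?_⟩
      rw [List.take_length]
      exact mem_runCalls_of_cons_mem calls x₀ l (by rintro rfl; simp at hl)
        (hgoal _ (by simp [hl]))
    obtain ⟨k, hk, hmin⟩ : ∃ k, (∀ l : List (Fin n), l.length = d + 1 →
        l ∈ runCalls n (calls.take k)) ∧ ∀ m < k, ¬ ∀ l : List (Fin n), l.length = d + 1 →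
        l ∈ runCalls n (calls.take m) :=
      ⟨Nat.find hex, Nat.find_spec hex, fun m hm => Nat.find_min hex hm⟩
    have hkd := ih (calls.take k) (fun c hc => hvalid c (List.mem_of_mem_take hc)) hk
    match k with
    | 0 =>
      have h := hk (List.replicate (d - 1) x₀ ++ [x₀, x₁]) (by simp; omega)
      rw [List.take_zero] at h
      rcases h with ⟨j, hj⟩ | ⟨p, j, hp⟩
      · have := congrArg List.length hj
        simp at this
      · have := (List.append_inj' hp rfl).2
        simp only [List.cons.injEq, and_true] at this
        exact absurd (this.1.trans this.2.symm) (by simp [x₀, x₁])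
    | k + 1 =>
      obtain ⟨f, hf, hfk⟩ : ∃ f : List (Fin n), f.length = d + 1 ∧
          f ∉ runCalls n (calls.take k) := by
        simpa using hmin k (by omega)
      have hf' : f ≠ [] := by
        rintro rfl
        simp at hf
      have hkl : k < calls.length := by
        by_contra! h
        refine hfk ?_
        have := hk f hf
        rwa [List.take_of_length_le (by omega)] at this ⊢
      have h₁ := card_knowers_append_le (calls.take (k + 1)) (calls.drop (k + 1)) hf' (hk f hf)
      have h₂ := card_knowers_concat_le_two (calls.take k) calls[k] hf' hfk
      rw [List.take_concat_get'] at h₂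
      have h₃ : knowers f (runCalls n calls) = Finset.univ :=
        Finset.filter_true_of_mem fun a _ => hgoal _ (by simp [hf])
      rw [List.take_append_drop, h₃, Finset.card_univ, Fintype.card_fin, List.length_drop] at h₁
      rw [List.length_take] at hkd
      rw [add_mul, one_mul]
      omega

end Fluents

theorem gossip_lower_bound (n : ℕ) (hn : 2 ≤ n) (G : SimpleGraph (Fin n))
    (d : ℕ) (hd : 1 ≤ d) (calls : List (Fin n × Fin n))
    (hvalid : ∀ c ∈ calls, G.Adj c.1 c.2)
    (hgoal : ∀ l : List (Fin n), l.length = d + 1 → l ∈ runCalls n calls) :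
    (d + 1) * (n - 2) ≤ calls.length :=
  mul_sub_two_le_length hn d hd calls (fun c hc => (hvalid c hc).ne) hgoal
end

section
/- For every r ≥ 1 and n ≥ 2, after any sequence of fewer than r(n−1) one-way calls among n agents (along arbitrary arcs), no agent knows T_r: there is no agent k such that every fluent of length r+1 beginning with k is true in the resulting state. -/
/-- A one-way call from agent `i` to agent `j`: the receiver `j` learns everything `i` knows
(and arbitrarily iterated self-knowledge of that), the sender gains nothing. -/
def sendStep {n : ℕ} (i j : Fin n) (S : Set (List (Fin n))) : Set (List (Fin n)) :=
  S ∪ {l | ∃ (k : ℕ) (f : List (Fin n)), 1 ≤ k ∧ f ≠ [] ∧ i :: f ∈ S ∧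
        (l = List.replicate k j ++ f ∨ l = List.replicate k j ++ i :: f)}

/-- The state resulting from applying a sequence of one-way calls to the initial state. -/
def runSends (n : ℕ) (calls : List (Fin n × Fin n)) : Set (List (Fin n)) :=
  calls.foldl (fun S c => sendStep c.1 c.2 S) (initState n)

section OneWayCalls

variable {n : ℕ}

theorem subset_sendStep (i j : Fin n) (S : Set (List (Fin n))) : S ⊆ sendStep i j S :=
  Set.subset_union_left

theorem subset_foldl_sendStep (calls : List (Fin n × Fin n)) (S : Set (List (Fin n))) :
    S ⊆ calls.foldl (fun S c => sendStep c.1 c.2 S) S := by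
  induction calls generalizing S with
  | nil => exact subset_rfl
  | cons c cs ih => exact (subset_sendStep c.1 c.2 S).trans (ih _)

theorem runSends_append_singleton (calls : List (Fin n × Fin n)) (c : Fin n × Fin n) :
    runSends n (calls ++ [c]) = sendStep c.1 c.2 (runSends n calls) := by
  simp [runSends]

theorem initState_subset_runSends (calls : List (Fin n × Fin n)) :
    initState n ⊆ runSends n calls :=
  subset_foldl_sendStep calls _

theorem append_mem_initState (q : List (Fin n)) {l : List (Fin n)} (hl : 2 ≤ l.length)
    (h : l ∈ initState n) : q ++ l ∈ initState n := by
  rcases h with ⟨j, rfl⟩ | ⟨p, j, rfl⟩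
  · simp at hl
  · exact Or.inr ⟨q ++ p, j, by simp⟩

theorem replicate_mem_initState {k : ℕ} (hk : 1 ≤ k) (j : Fin n) :
    List.replicate k j ∈ initState n := by
  obtain ⟨k, rfl⟩ := Nat.exists_eq_add_of_le' hk
  cases k with
  | zero => exact Or.inl ⟨j, rfl⟩
  | succ k => exact Or.inr ⟨List.replicate k j, j, by simp [List.replicate_succ']⟩

/-- Knowledge is factual: if an agent knows a fluent, then that fluent is true. -/
theorem mem_runSends_of_cons_mem (calls : List (Fin n × Fin n)) {a : Fin n}
    {l : List (Fin n)} (hl : l ≠ []) (h : a :: l ∈ runSends n calls) :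
    l ∈ runSends n calls := by
  induction calls using List.reverseRecOn generalizing a l with
  | nil =>
    rcases h with ⟨j, h⟩ | ⟨p, j, h⟩
    · simp_all
    · cases p with
      | nil =>
        simp only [List.nil_append, List.cons.injEq] at h
        exact Or.inl ⟨j, h.2⟩
      | cons b p =>
        simp only [List.cons_append, List.cons.injEq] at h
        exact Or.inr ⟨p, j, h.2⟩
  | append_singleton cs c ih =>
    rw [runSends_append_singleton] at h ⊢
    rcases h with h | ⟨k, f, hk, hf, hif, h⟩
    · exact Or.inl (ih hl h)
    · obtain ⟨k, rfl⟩ := Nat.exists_eq_add_of_le' hk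
      simp only [List.replicate_succ, List.cons_append, List.cons.injEq] at h
      cases k with
      | zero =>
        simp only [List.replicate_zero, List.nil_append] at h
        rcases h with ⟨-, rfl⟩ | ⟨-, rfl⟩
        · exact Or.inl (ih hf hif)
        · exact Or.inl hif
      | succ k => exact Or.inr ⟨k + 1, f, by omega, hf, hif, h.imp And.right And.right⟩

/-- The last entry of a true fluent may be dropped when it differs from the entry before it. -/
theorem mem_runSends_of_append_pair_mem (calls : List (Fin n × Fin n)) {p : List (Fin n)}
    {x j : Fin n} (hxj : x ≠ j) (h : p ++ [x, j] ∈ runSends n calls) :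
    p ++ [x] ∈ runSends n calls := by
  induction calls using List.reverseRecOn generalizing p with
  | nil =>
    rcases h with ⟨y, h⟩ | ⟨q, y, h⟩
    · have := congrArg List.length h
      simp at this
    · have := List.append_inj_right' h rfl
      simp_all
  | append_singleton cs c ih =>
    have hinit := (initState_subset_runSends cs).trans (subset_sendStep c.1 c.2 _)
    rw [runSends_append_singleton] at h ⊢
    rcases h with h | ⟨k, f, hk, hf, hif, h⟩
    · exact Or.inl (ih h)
    · obtain ⟨g, z, rfl⟩ := (List.eq_nil_or_concat' f).resolve_left hf
      have key : p ++ [x] = List.replicate k c.2 ++ g ∨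
          p ++ [x] = List.replicate k c.2 ++ c.1 :: g := by
        refine h.imp (fun h => ?_) (fun h => ?_) <;>
        · refine List.append_inj_left' (t₁ := [j]) (t₂ := [z]) ?_ rfl
          simpa using h
      have hz : z = j := by
        rcases h with h | h <;>
            simpa [List.getLast?_cons] using (congrArg List.getLast? h).symm
      subst hz
      rcases List.eq_nil_or_concat' g with rfl | ⟨g, y, rfl⟩
      · rcases key with key | key
        · rw [key, List.append_nil]
          exact hinit (replicate_mem_initState hk c.2)
        · refine Or.inr ⟨k, [c.1], hk, by simp, ?_, Or.inl key⟩
          exact initState_subset_runSends cs (Or.inr ⟨[], c.1, rfl⟩)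
      · have hy : x = y := by
          rcases key with h | h <;>
            simpa [List.getLast?_cons] using congrArg List.getLast? h
        subst hy
        refine Or.inr ⟨k, g ++ [x], hk, by simp, ?_, by simpa using key⟩
        exact ih (p := c.1 :: g) (by simpa using hif)

/-- If `j` never sends, then no fluent about the secret of `j` becomes true that was not true
initially. -/
theorem mem_initState_of_forall_ne (calls : List (Fin n × Fin n)) {j : Fin n}
    (hj : ∀ c ∈ calls, c.1 ≠ j) {l : List (Fin n)} (hl : l.getLast? = some j)
    (h : l ∈ runSends n calls) : l ∈ initState n := by
  induction calls using List.reverseRecOn generalizing l with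
  | nil => exact h
  | append_singleton cs c ih =>
    rw [runSends_append_singleton] at h
    have ih' := @ih (fun c hc => hj c (by simp [hc]))
    have hcj : c.1 ≠ j := hj c (by simp)
    rcases h with h | ⟨k, f, hk, hf, hif, h⟩
    · exact ih' hl h
    · obtain ⟨g, z, rfl⟩ := (List.eq_nil_or_concat' f).resolve_left hf
      have hz : z = j := by rcases h with rfl | rfl <;> simpa [List.getLast?_cons] using hl
      subst hz
      have hmem := ih' (by simp [List.getLast?_cons]) hif
      rcases h with rfl | rfl
      · rcases hmem with ⟨y, hy⟩ | ⟨p, y, hp⟩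
        · simp at hy
        · cases p with
          | nil =>
            have hzy : z = y := by simpa [List.getLast?_cons] using congrArg List.getLast? hp
            exact absurd ((List.cons.inj hp).1.trans hzy.symm) hcj
          | cons b p =>
            simp only [List.cons_append, List.cons.injEq] at hp
            rw [hp.2]
            exact Or.inr ⟨List.replicate k c.2 ++ p, y, by simp⟩
      · exact append_mem_initState _ (by simp) hmem

/-- Sends preserve inclusion between the fluents about the secret of `j`. -/
theorem mem_foldl_sendStep_of_getLast? {j : Fin n} (calls : List (Fin n × Fin n))
    {S T : Set (List (Fin n))} (hST : ∀ l ∈ S, l.getLast? = some j → l ∈ T)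
    {l : List (Fin n)} (hl : l.getLast? = some j)
    (h : l ∈ calls.foldl (fun S c => sendStep c.1 c.2 S) S) :
    l ∈ calls.foldl (fun S c => sendStep c.1 c.2 S) T := by
  induction calls generalizing S T with
  | nil => exact hST l h hl
  | cons c cs ih =>
    refine ih ?_ h
    rintro l (h | ⟨k, f, hk, hf, hif, h⟩) hl
    · exact Or.inl (hST l h hl)
    · refine Or.inr ⟨k, f, hk, hf, hST _ hif ?_, h⟩
      obtain ⟨g, z, rfl⟩ := (List.eq_nil_or_concat' f).resolve_left hf
      rcases h with rfl | rfl <;> simpa [List.getLast?_cons] using hl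

/-- Calls made before the first call sent by `j` are irrelevant for the secret of `j`. -/
theorem mem_runSends_of_append {A B : List (Fin n × Fin n)} {j : Fin n}
    (hj : ∀ c ∈ A, c.1 ≠ j) {l : List (Fin n)} (hl : l.getLast? = some j)
    (h : l ∈ runSends n (A ++ B)) : l ∈ runSends n B := by
  rw [runSends, List.foldl_append] at h
  exact mem_foldl_sendStep_of_getLast? B
    (fun l hl' hlj => mem_initState_of_forall_ne A hj hlj hl') hl h

/-- Agent `k` knows all fluents of length `r` after the given calls. -/
def KnowsAll (calls : List (Fin n × Fin n)) (k : Fin n) (r : ℕ) : Prop :=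
  ∀ l : List (Fin n), l.length = r + 1 → l.head? = some k → l ∈ runSends n calls

theorem KnowsAll.of_append {A B : List (Fin n × Fin n)} {j k : Fin n} {r : ℕ}
    (hj : ∀ c ∈ A, c.1 ≠ j) (h : KnowsAll (A ++ B) k (r + 1)) : KnowsAll B k r := by
  intro l hlen hk
  have hne : l ≠ [] := by rintro rfl; simp at hlen
  obtain ⟨p, x, rfl⟩ := (List.eq_nil_or_concat' l).resolve_left hne
  by_cases hx : x = j
  · subst hx
    refine mem_runSends_of_cons_mem B (a := k) hne (mem_runSends_of_append hj ?_ (h _ ?_ ?_))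
    · simp [List.getLast?_cons]
    · simpa using hlen
    · simp
  · refine mem_runSends_of_append_pair_mem B hx (mem_runSends_of_append hj ?_ (h _ ?_ ?_))
    · simp [List.getLast?_append]
    · simpa using hlen
    · rw [← hk]
      cases p <;> simp

theorem exists_notMem_of_length_lt {s : List (Fin n)} (hs : s.length < n) :
    ∃ j, j ∉ s := by
  by_contra! h
  have := Finset.card_le_card (fun j _ => List.mem_toFinset.2 (h j) : Finset.univ ⊆ s.toFinset)
  have := s.toFinset_card_le
  simp at *
  omega

theorem not_knowsAll_of_length_lt (calls : List (Fin n × Fin n)) (k : Fin n) (r : ℕ)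
    (hlen : calls.length < (r + 1) * (n - 1)) : ¬ KnowsAll calls k (r + 1) := by
  have hn : 0 < n := k.pos
  induction r generalizing calls with
  | zero =>
    intro h
    obtain ⟨j, hj⟩ := exists_notMem_of_length_lt (s := k :: calls.map Prod.fst)
      (by simp; omega)
    rw [List.mem_cons, not_or] at hj
    have hinit := mem_initState_of_forall_ne calls
      (fun c hc hcj => hj.2 (List.mem_map.2 ⟨c, hc, hcj⟩)) (l := [k, j]) rfl (h _ rfl rfl)
    rcases hinit with ⟨y, hy⟩ | ⟨p, y, hp⟩
    · simp at hy
    · have := List.append_inj_right' (s₁ := []) hp rfl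
      simp_all
  | succ r ih =>
    intro h
    obtain ⟨j, hj⟩ := exists_notMem_of_length_lt (s := (calls.take (n - 1)).map Prod.fst)
      (by simp; omega)
    rw [← List.take_append_drop (n - 1) calls] at h
    refine ih (calls.drop (n - 1)) ?_
      (h.of_append fun c hc hcj => hj (List.mem_map.2 ⟨c, hc, hcj⟩))
    rw [List.length_drop]
    have : (r + 1 + 1) * (n - 1) = (r + 1) * (n - 1) + (n - 1) := by ring
    have : (r + 1) * (n - 1) = r * (n - 1) + (n - 1) := by ring
    omega

end OneWayCalls

theorem no_agent_knows_Tr (n r : ℕ) (hn : 2 ≤ n) (hr : 1 ≤ r)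
    (calls : List (Fin n × Fin n)) (hc : ∀ c ∈ calls, c.1 ≠ c.2)
    (hlen : calls.length < r * (n - 1)) :
    ¬ ∃ k : Fin n, ∀ l : List (Fin n),
      l.length = r + 1 → l.head? = some k → l ∈ runSends n calls := by
  obtain ⟨r, rfl⟩ := Nat.exists_eq_add_of_le' hr
  rintro ⟨k, h⟩
  exact not_knowsAll_of_length_lt calls k r hlen h
end

section
/- Let L be a function assigning to each of the n agents (n ≥ 2) a natural-number level. On the complete graph, there exists a finite plan of calls and CHANGE actions whose final state satisfies: the fluent (i, j) is true for all agents i, j with L(i) > L(j), and the fluent (i, j) is false for all agents i, j with L(i) < L(j); i.e., all secrets are communicated upwards in the hierarchy but not downwards. -/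
/-- The action `CHANGE_i`: every fluent `K_{i_1} ... K_{i_r} s_i` with `i_r ≠ i` becomes false. -/
def changeStep {n : ℕ} (i : Fin n) (S : Set (List (Fin n))) : Set (List (Fin n)) :=
  S \ {l | ∃ p k, l = p ++ [k, i] ∧ k ≠ i}

/-- An action is either a two-way call (`Sum.inl`) or a `CHANGE` action (`Sum.inr`). -/
def applyAct {n : ℕ} (S : Set (List (Fin n))) (a : (Fin n × Fin n) ⊕ Fin n) :
    Set (List (Fin n)) :=
  match a with
  | Sum.inl c => callStep c.1 c.2 S
  | Sum.inr i => changeStep i S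

/-- The state resulting from applying a plan (a sequence of calls and CHANGE actions). -/
def runPlan (n : ℕ) (plan : List ((Fin n × Fin n) ⊕ Fin n)) : Set (List (Fin n)) :=
  plan.foldl applyAct (initState n)

theorem pair_mem_callStep {n : ℕ} {i j a b : Fin n} {S : Set (List (Fin n))} :
    [a, b] ∈ callStep i j S ↔
      [a, b] ∈ S ∨ (a = i ∨ a = j) ∧ ([i, b] ∈ S ∨ [j, b] ∈ S) := by
  refine or_congr_right ⟨?_, ?_⟩
  · rintro ⟨w, f, hl, hw, hwa, hf, hS⟩
    match w, f with
    | [], _ => exact absurd rfl hw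
    | _, [] => exact absurd rfl hf
    | [x], [y] =>
      simp only [List.cons_append, List.nil_append, List.cons.injEq, and_true] at hl
      obtain ⟨rfl, rfl⟩ := hl
      exact ⟨hwa a (by simp), hS⟩
    | [x], y :: z :: t => simp at hl
    | x :: x' :: t, y :: t' => simp at hl
  · rintro ⟨ha, hS⟩
    exact ⟨[a], [b], rfl, by simp, by simpa using ha, by simp, hS⟩

theorem pair_mem_changeStep {n : ℕ} {i a b : Fin n} {S : Set (List (Fin n))} :
    [a, b] ∈ changeStep i S ↔ [a, b] ∈ S ∧ (b = i → a = i) := by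
  refine and_congr_right fun _ => ⟨?_, ?_⟩
  · rintro h rfl
    by_contra hab
    exact h ⟨[], a, rfl, hab⟩
  · rintro h ⟨p, k, hl, hk⟩
    match p with
    | [] =>
      simp only [List.nil_append, List.cons.injEq, and_true] at hl
      exact hk (hl.1 ▸ h hl.2)
    | x :: t => simpa using congrArg List.length hl

/-- For each pair `(i, j)` in turn, a call between `i` and `j` followed by `CHANGE_i`. -/
def callChangePlan {n : ℕ} (ps : List (Fin n × Fin n)) : List ((Fin n × Fin n) ⊕ Fin n) :=
  ps.flatMap fun p => [Sum.inl p, Sum.inr p.1]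

theorem pair_mem_callChange {n : ℕ} {i j a b : Fin n} {S : Set (List (Fin n))} :
    [a, b] ∈ changeStep i (callStep i j S) ↔
      ([a, b] ∈ S ∨ (a = i ∨ a = j) ∧ ([i, b] ∈ S ∨ [j, b] ∈ S)) ∧ (b = i → a = i) := by
  rw [pair_mem_changeStep, pair_mem_callStep]

theorem foldl_callChangePlan_cons {n : ℕ} (p : Fin n × Fin n) (ps : List (Fin n × Fin n))
    (S : Set (List (Fin n))) :
    (callChangePlan (p :: ps)).foldl applyAct S =
      (callChangePlan ps).foldl applyAct (changeStep p.1 (callStep p.1 p.2 S)) := rfl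

/-- Running `callChangePlan` never loses secrets lying below all the agents that change. -/
theorem pair_mem_foldl_callChangePlan {n : ℕ} {a b : Fin n} (ps : List (Fin n × Fin n))
    (S : Set (List (Fin n))) (hb : ∀ p ∈ ps, b = p.1 → a = p.1) (h : [a, b] ∈ S) :
    [a, b] ∈ (callChangePlan ps).foldl applyAct S := by
  induction ps generalizing S with
  | nil => exact h
  | cons p ps ih =>
    rw [foldl_callChangePlan_cons]
    exact ih _ (fun q hq => hb q (List.mem_cons_of_mem _ hq))
      (pair_mem_callChange.2 ⟨Or.inl h, hb p List.mem_cons_self⟩)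

/-- If the pairs go upwards and are sorted by the level of the lower agent, then every upper agent
learns the secret of its lower agent. -/
theorem pair_mem_of_mem_callChangePlan {n : ℕ} (L : Fin n → ℕ) (ps : List (Fin n × Fin n))
    (hsort : ps.Pairwise fun p q => L p.2 ≤ L q.2) (hlt : ∀ p ∈ ps, L p.2 < L p.1)
    (S : Set (List (Fin n))) (hS : ∀ a, [a, a] ∈ S) {q : Fin n × Fin n} (hq : q ∈ ps) :
    [q.1, q.2] ∈ (callChangePlan ps).foldl applyAct S := by
  induction ps generalizing S with
  | nil => simp at hq
  | cons p ps ih =>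
    rw [List.pairwise_cons] at hsort
    rw [foldl_callChangePlan_cons]
    rcases List.mem_cons.1 hq with rfl | hq
    · refine pair_mem_foldl_callChangePlan ps _ (fun r hr h => ?_)
        (pair_mem_callChange.2 ⟨Or.inr ⟨Or.inl rfl, Or.inr (hS _)⟩, fun _ => rfl⟩)
      have h₁ := hsort.1 r hr
      have h₂ := hlt r (List.mem_cons_of_mem _ hr)
      rw [h] at h₁
      omega
    · exact ih hsort.2 (fun r hr => hlt r (List.mem_cons_of_mem _ hr)) _
        (fun a => pair_mem_callChange.2 ⟨Or.inl (hS a), id⟩) hq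

/-- If the pairs go upwards and are sorted by the level of the lower agent, then no secret is
learned downwards. -/
theorem level_le_of_pair_mem_callChangePlan {n : ℕ} (L : Fin n → ℕ) (ps : List (Fin n × Fin n))
    (hsort : ps.Pairwise fun p q => L p.2 ≤ L q.2) (hlt : ∀ p ∈ ps, L p.2 < L p.1)
    (S : Set (List (Fin n))) (hS : ∀ a b, [a, b] ∈ S → L b ≤ L a)
    (hlow : ∀ a b, [a, b] ∈ S → a ≠ b → ∀ p ∈ ps, L b ≤ L p.2) {a b : Fin n}
    (h : [a, b] ∈ (callChangePlan ps).foldl applyAct S) : L b ≤ L a := by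
  induction ps generalizing S with
  | nil => exact hS a b h
  | cons p ps ih =>
    rw [List.pairwise_cons] at hsort
    rw [foldl_callChangePlan_cons] at h
    have hp := hlt p List.mem_cons_self
    have key : ∀ a b, [a, b] ∈ changeStep p.1 (callStep p.1 p.2 S) → a ≠ b →
        L b ≤ L p.2 ∧ L b ≤ L a := by
      intro a b hab hne
      obtain ⟨hab | ⟨ha, hab⟩, hch⟩ := pair_mem_callChange.1 hab
      · exact ⟨hlow a b hab hne p List.mem_cons_self, hS a b hab⟩
      · have hb : L b ≤ L p.2 := by
          rcases hab with hab | hab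
          · exact hlow _ b hab (fun e => hne ((hch e.symm).trans e)) p List.mem_cons_self
          · exact hS _ _ hab
        refine ⟨hb, ?_⟩
        rcases ha with rfl | rfl <;> omega
    refine ih hsort.2 (fun r hr => hlt r (List.mem_cons_of_mem _ hr)) _ (fun a b hab => ?_)
      (fun a b hab hne r hr => (key a b hab hne).1.trans (hsort.1 r hr)) h
    rcases eq_or_ne a b with rfl | hne
    · exact le_rfl
    · exact (key a b hab hne).2

theorem pair_mem_initState {n : ℕ} {a b : Fin n} : [a, b] ∈ initState n ↔ a = b := by
  constructor
  · rintro (⟨j, h⟩ | ⟨p, j, h⟩)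
    · simp at h
    · match p with
      | [] => simp_all
      | x :: t => simpa using congrArg List.length h
  · rintro rfl
    exact Or.inr ⟨[], a, rfl⟩

theorem hierarchy_gossip (n : ℕ) (hn : 2 ≤ n) (L : Fin n → ℕ) :
    ∃ plan : List ((Fin n × Fin n) ⊕ Fin n),
      (∀ c : Fin n × Fin n, Sum.inl c ∈ plan → c.1 ≠ c.2) ∧
      (∀ i j : Fin n, L j < L i → [i, j] ∈ runPlan n plan) ∧
      ∀ i j : Fin n, L i < L j → [i, j] ∉ runPlan n plan := by
  let ps : List (Fin n × Fin n) :=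
    (Finset.univ.filter fun p : Fin n × Fin n => L p.2 < L p.1).toList.mergeSort
      fun p q => decide (L p.2 ≤ L q.2)
  have hmem : ∀ p, p ∈ ps ↔ L p.2 < L p.1 := by simp [ps]
  have hsort : ps.Pairwise fun p q => L p.2 ≤ L q.2 := by
    have := List.pairwise_mergeSort (le := fun p q : Fin n × Fin n => decide (L p.2 ≤ L q.2))
      (fun _ _ _ h₁ h₂ => by simp only [decide_eq_true_eq] at *; exact h₁.trans h₂)
      (fun p q => by simpa using le_total (L p.2) (L q.2))
      (Finset.univ.filter fun p : Fin n × Fin n => L p.2 < L p.1).toList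
    simpa [ps] using this
  have hlt : ∀ p ∈ ps, L p.2 < L p.1 := fun p hp => (hmem p).1 hp
  refine ⟨callChangePlan ps, fun c hc => ?_, fun i j hij => ?_, fun i j hij h => ?_⟩
  · have hc' : c ∈ ps := by simpa [callChangePlan] using hc
    intro e
    have := hlt c hc'
    rw [e] at this
    exact lt_irrefl _ this
  · exact pair_mem_of_mem_callChangePlan L ps hsort hlt _ (fun a => pair_mem_initState.2 rfl)
      ((hmem (i, j)).2 hij)
  · refine absurd (level_le_of_pair_mem_callChangePlan L ps hsort hlt _ (fun a b hab => ?_)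
      (fun a b hab hne => absurd (pair_mem_initState.1 hab) hne) h) (not_le.2 hij)
    rw [pair_mem_initState.1 hab]
end
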